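/- For every τ in the upper half-plane H, ℘̃a(τ/(2τ+1), 2τ/(2τ+1))² = (2τ+1)⁴ · ℘̃a(τ, 2τ)²; consequently the function τ ↦ ℘̃a(τ, 2τ)² is a modular form of weight 4 for Γ₀(2). -/

import Mathlib

open Complex

/-- The normalized Weierstrass function
`℘a(z,τ) = π⁻² (1/z² + Σ_{ω ∈ Λ_τ, ω ≠ 0} (1/(z-ω)² − 1/ω²))`, where `Λ_τ = ℤ + τℤ`. -/
noncomputable def wpa (z τ : ℂ) : ℂ :=
  (Real.pi : ℂ)⁻¹ ^ 2 * (1 / z ^ 2 +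
    ∑' p : ℤ × ℤ, if p = 0 then 0 else
      (1 / (z - ((p.1 : ℂ) + (p.2 : ℂ) * τ)) ^ 2 - 1 / ((p.1 : ℂ) + (p.2 : ℂ) * τ) ^ 2))

/-- The renormalized function
`℘̃a(z,τ) = π⁻² Σ_{(n,m)∈ℤ²} (1/(z+(n+1/2)+(m+1/2)τ)² − 1/((n+1/2)+(m+1/2)τ)²)`. -/
noncomputable def wpt (z τ : ℂ) : ℂ :=
  (Real.pi : ℂ)⁻¹ ^ 2 *
    ∑' p : ℤ × ℤ,
      (1 / (z + ((p.1 : ℂ) + 1 / 2) + ((p.2 : ℂ) + 1 / 2) * τ) ^ 2 -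
        1 / (((p.1 : ℂ) + 1 / 2) + ((p.2 : ℂ) + 1 / 2) * τ) ^ 2)


/-- The period pair `(1, 2τ)`. -/
noncomputable def ppair (τ : ℂ) (h : 0 < τ.im) : PeriodPair where
  ω₁ := 1
  ω₂ := 2 * τ
  indep := by
    rw [LinearIndependent.pair_iff]
    intro s t hst
    have h2 := congrArg Complex.im hst
    have h1 := congrArg Complex.re hst
    simp at h1 h2
    have ht : t = 0 := by
      rcases h2 with h2 | h2
      · exact h2
      · exact absurd h2 h.ne'
    subst ht
    simpa using h1

/-- The summand of `wpt τ (2τ)`. -/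
noncomputable def wterm (τ : ℂ) (p : ℤ × ℤ) : ℂ :=
  1 / (τ + ((p.1 : ℂ) + 1 / 2) + ((p.2 : ℂ) + 1 / 2) * (2 * τ)) ^ 2 -
        1 / (((p.1 : ℂ) + 1 / 2) + ((p.2 : ℂ) + 1 / 2) * (2 * τ)) ^ 2

lemma wpt_eq_tsum (τ : ℂ) : wpt τ (2 * τ) = (Real.pi : ℂ)⁻¹ ^ 2 * ∑' p, wterm τ p := rfl

/-- Reindexing of `ℤ × ℤ`. -/
def reidx : ℤ × ℤ ≃ ℤ × ℤ where
  toFun p := (-p.1, -(p.2 + 1))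
  invFun p := (-p.1, -p.2 - 1)
  left_inv p := by ext <;> simp
  right_inv p := by ext <;> simp

lemma hasSum_wterm (τ : ℂ) (h : 0 < τ.im) :
    HasSum (wterm τ) ((ppair τ h).weierstrassP (1 / 2) - (ppair τ h).weierstrassP (1 / 2 - τ)) := by
  have h1 := ((ppair τ h).hasSum_weierstrassP (1 / 2)).sub
    ((ppair τ h).hasSum_weierstrassP (1 / 2 - τ))
  rw [← (reidx.trans (ppair τ h).latticeEquivProd.symm.toEquiv).hasSum_iff] at h1
  convert! h1 using 1
  ext p
  have : (((ppair τ h).latticeEquivProd.symm (reidx p) : (ppair τ h).lattice) : ℂ)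
      = -(p.1 : ℂ) - (p.2 + 1) * (2 * τ) := by
    rw [PeriodPair.latticeEquiv_symm_apply]
    simp [reidx, ppair]; ring
  simp only [Function.comp_apply, Equiv.trans_apply, LinearEquiv.coe_toEquiv]
  rw [this]
  simp only [wterm]
  ring_nf

lemma wpt_eq (τ : ℂ) (h : 0 < τ.im) : wpt τ (2 * τ) = (Real.pi : ℂ)⁻¹ ^ 2 *
    ((ppair τ h).weierstrassP (1 / 2) - (ppair τ h).weierstrassP (1 / 2 - τ)) := by
  rw [wpt_eq_tsum, (hasSum_wterm τ h).tsum_eq]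

lemma weierstrassP_scale (L L' : PeriodPair) (u : ℂ) (hu : u ≠ 0)
    (h : ∀ x, x ∈ L'.lattice ↔ u * x ∈ L.lattice) (z : ℂ) :
    L'.weierstrassP z = u ^ 2 * L.weierstrassP (u * z) := by
  let e : L'.lattice ≃ L.lattice :=
    { toFun := fun x => ⟨u * x, (h x).1 x.2⟩
      invFun := fun y => ⟨u⁻¹ * y, (h _).2 (by rw [mul_inv_cancel_left₀ hu]; exact y.2)⟩
      left_inv := fun x => by ext; simp [hu]
      right_inv := fun x => by ext; simp [hu] }
  unfold PeriodPair.weierstrassP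
  rw [← e.tsum_eq, ← tsum_mul_left]
  congr 1
  ext x
  have : ((e x : L.lattice) : ℂ) = u * x := rfl
  rw [this, ← mul_sub, mul_pow, mul_pow, mul_sub]
  field_simp

lemma weierstrassP_congr (L : PeriodPair) (z w : ℂ) (h : z - w ∈ L.lattice) :
    L.weierstrassP z = L.weierstrassP w := by
  have := L.weierstrassP_add_coe w ⟨z - w, h⟩
  simpa using this

lemma mem_ppair {τ : ℂ} {h : 0 < τ.im} {x : ℂ} :
    x ∈ (ppair τ h).lattice ↔ ∃ m n : ℤ, m + n * (2 * τ) = x := by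
  rw [PeriodPair.mem_lattice]; simp [ppair]

lemma wpt_core (τ z : ℂ) (hτ : 0 < τ.im) (hz : 0 < z.im) (a b c d : ℤ) (hdet : a * d - 2 * b * c = 1)
    (hzz : z * (2 * c * τ + d) = a * τ + b) :
    wpt z (2 * z) ^ 2 = (2 * c * τ + d) ^ 4 * wpt τ (2 * τ) ^ 2 := by
  set u : ℂ := 2 * c * τ + d with hu
  have hdetC : (a : ℂ) * d - 2 * b * c = 1 := by exact_mod_cast hdet
  have hu0 : u ≠ 0 := by
    intro h0
    rw [h0, mul_zero] at hzz
    have : (a : ℂ) * u - 2 * c * (a * τ + b) = 1 := by rw [hu]; linear_combination hdetC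
    rw [h0, ← hzz] at this
    simp at this
  have hL : ∀ x, x ∈ (ppair z hz).lattice ↔ u * x ∈ (ppair τ hτ).lattice := by
    intro x
    rw [mem_ppair, mem_ppair]
    constructor
    · rintro ⟨m, n, rfl⟩
      refine ⟨m * d + n * (2 * b), m * c + n * a, ?_⟩
      push_cast
      linear_combination (-2 * n) * hzz + m * hu - m * hu
    · rintro ⟨m, n, hmn⟩
      refine ⟨a * m - 2 * b * n, -c * m + d * n, ?_⟩
      apply mul_left_cancel₀ hu0
      rw [← hmn]
      push_cast
      linear_combination (2 * (-c * m + d * n)) * hzz + (a * m - 2 * b * n) * hu + (m + 2 * n * τ) * hdetC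
  rw [wpt_eq z hz, wpt_eq τ hτ, weierstrassP_scale (ppair τ hτ) _ u hu0 hL,
    weierstrassP_scale (ppair τ hτ) _ u hu0 hL]
  have hodd : Odd (a * d) := ⟨b * c, by linarith⟩
  obtain ⟨⟨a', rfl⟩, ⟨d', rfl⟩⟩ := Int.odd_mul.1 hodd
  set P := (ppair τ hτ).weierstrassP with hP
  rcases Int.even_or_odd c with ⟨c', rfl⟩ | ⟨c', rfl⟩
  · have e1 : P (u * (1 / 2)) = P (1 / 2) := by
      apply weierstrassP_congr
      rw [mem_ppair]
      refine ⟨d', c', ?_⟩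
      rw [hu]; push_cast; ring
    have e2 : P (u * (1 / 2 - z)) = P (1 / 2 - τ) := by
      apply weierstrassP_congr
      rw [mem_ppair]
      refine ⟨d' - b, c' - a', ?_⟩
      rw [mul_sub, mul_comm u z, hzz, hu]; push_cast; ring
    rw [e1, e2]; ring
  · have e1 : P (u * (1 / 2)) = P (1 / 2 - τ) := by
      apply weierstrassP_congr
      rw [mem_ppair]
      refine ⟨d', c' + 1, ?_⟩
      rw [hu]; push_cast; ring
    have e2 : P (u * (1 / 2 - z)) = P (1 / 2) := by
      apply weierstrassP_congr
      rw [mem_ppair]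
      refine ⟨d' - b, c' - a', ?_⟩
      rw [mul_sub, mul_comm u z, hzz, hu]; push_cast; ring
    rw [e1, e2]; ring

/-- `Σ_n 1/(w+n)²`. -/
noncomputable def rowS (w : ℂ) : ℂ := ∑' n : ℤ, 1 / (w + n) ^ 2

lemma summable_rowS (w : ℂ) : Summable fun n : ℤ => 1 / (w + n) ^ 2 := by
  have := EisensteinSeries.linear_right_summable w 1 (k := 2) le_rfl
  refine this.congr fun n => ?_
  simp

lemma rowS_neg (w : ℂ) : rowS (-w) = rowS w := by
  unfold rowS
  rw [← (Equiv.neg ℤ).tsum_eq]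
  congr 1; ext n
  simp only [Equiv.neg_apply]
  push_cast
  rw [← neg_add, neg_sq]

lemma rowS_add_int (w : ℂ) (k : ℤ) : rowS (w + k) = rowS w := by
  unfold rowS
  rw [← (Equiv.addLeft k).tsum_eq (fun n : ℤ => 1 / (w + n) ^ 2)]
  congr 1; ext n
  simp only [Equiv.coe_addLeft]
  push_cast
  rw [add_assoc]

lemma rowS_formula (w : ℂ) (hw : 0 < w.im) :
    rowS w = (-2 * Real.pi * I) ^ 2 *
      (cexp (2 * Real.pi * I * w) / (1 - cexp (2 * Real.pi * I * w)) ^ 2) := by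
  have h := EisensteinSeries.qExpansion_identity (k := 1) le_rfl ⟨w, hw⟩
  have hq := UpperHalfPlane.norm_exp_two_pi_I_lt_one ⟨w, hw⟩
  simp only [Nat.reduceAdd, pow_one, Nat.factorial_one, Nat.cast_one, div_one] at h
  unfold rowS
  erw [h]
  congr 1
  exact tsum_coe_mul_geometric_of_norm_lt_one hq

lemma norm_q (w : ℂ) : ‖cexp (2 * Real.pi * I * w)‖ = Real.exp (-(2 * Real.pi * w.im)) := by
  rw [Complex.norm_exp]; congr 1; simp

lemma rowS_bound_pos (δ : ℝ) (hδ : 0 < δ) (k : ℕ) (hk : 1 ≤ k) (w : ℂ) (hw : k * δ ≤ w.im) :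
    ‖rowS w‖ ≤ (2 * Real.pi) ^ 2 / (1 - Real.exp (-(2 * Real.pi * δ))) ^ 2 *
      Real.exp (-(2 * Real.pi * δ)) ^ k := by
  have hk' : (1 : ℝ) ≤ k := by exact_mod_cast hk
  have hδw : δ ≤ w.im := by nlinarith
  rw [rowS_formula w (hδ.trans_le hδw)]
  have hpi := Real.pi_pos
  have hr1 : Real.exp (-(2 * Real.pi * δ)) < 1 := by
    rw [Real.exp_lt_one_iff]; have : 0 < 2 * Real.pi * δ := by positivity
    linarith
  have h1 : ‖cexp (2 * Real.pi * I * w)‖ ≤ Real.exp (-(2 * Real.pi * δ)) ^ k := by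
    rw [norm_q, ← Real.exp_nat_mul]
    apply Real.exp_le_exp.2
    have := mul_le_mul_of_nonneg_left hw (by positivity : 0 ≤ 2 * Real.pi)
    linarith
  have h2 : 1 - Real.exp (-(2 * Real.pi * δ)) ≤ ‖1 - cexp (2 * Real.pi * I * w)‖ := by
    have h3 : ‖cexp (2 * Real.pi * I * w)‖ ≤ Real.exp (-(2 * Real.pi * δ)) := by
      rw [norm_q]
      apply Real.exp_le_exp.2
      have := mul_le_mul_of_nonneg_left hδw (by positivity : 0 ≤ 2 * Real.pi)
      linarith
    have := norm_sub_norm_le (1 : ℂ) (cexp (2 * Real.pi * I * w))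
    rw [norm_one] at this
    linarith
  rw [norm_mul, norm_div, norm_pow, norm_pow]
  have h4 : ‖(-2 * Real.pi * I : ℂ)‖ = 2 * Real.pi := by
    simp [abs_of_pos hpi]
  rw [h4, div_mul_eq_mul_div, mul_div_assoc]
  gcongr

lemma rowS_bound (δ : ℝ) (hδ : 0 < δ) (k : ℕ) (hk : 1 ≤ k) (w : ℂ) (hw : k * δ ≤ |w.im|) :
    ‖rowS w‖ ≤ (2 * Real.pi) ^ 2 / (1 - Real.exp (-(2 * Real.pi * δ))) ^ 2 *
      Real.exp (-(2 * Real.pi * δ)) ^ k := by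
  rcases le_abs.1 hw with h | h
  · exact rowS_bound_pos δ hδ k hk w h
  · rw [← rowS_neg]
    exact rowS_bound_pos δ hδ k hk _ (by simpa using h)

lemma rowS_differentiableAt_pos (w : ℂ) (hw : 0 < w.im) : DifferentiableAt ℂ rowS w := by
  have : rowS =ᶠ[nhds w] fun w => (-2 * Real.pi * I) ^ 2 *
      (cexp (2 * Real.pi * I * w) / (1 - cexp (2 * Real.pi * I * w)) ^ 2) := by
    filter_upwards [(isOpen_lt continuous_const Complex.continuous_im).mem_nhds hw] with z hz
    exact rowS_formula z hz
  refine DifferentiableAt.congr_of_eventuallyEq ?_ this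
  have hne : (1 - cexp (2 * Real.pi * I * w)) ^ 2 ≠ 0 := by
    apply pow_ne_zero
    intro h0
    have h1 := UpperHalfPlane.norm_exp_two_pi_I_lt_one ⟨w, hw⟩
    have h2 : cexp (2 * Real.pi * I * w) = 1 := (sub_eq_zero.1 h0).symm
    change ‖cexp (2 * Real.pi * I * w)‖ < 1 at h1
    rw [h2, norm_one] at h1
    exact lt_irrefl _ h1
  fun_prop (disch := exact hne)

lemma rowS_differentiableAt (w : ℂ) (hw : w.im ≠ 0) : DifferentiableAt ℂ rowS w := by
  rcases lt_or_gt_of_ne hw with h | h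
  · have h1 : DifferentiableAt ℂ rowS (-w) := rowS_differentiableAt_pos _ (by simpa using h)
    have h2 : rowS = rowS ∘ Neg.neg := by ext z; simp [rowS_neg]
    rw [h2]
    exact h1.comp w differentiable_neg.differentiableAt
  · exact rowS_differentiableAt_pos w h

lemma summable_pow_natAbs (C r : ℝ) (h0 : 0 ≤ r) (h1 : r < 1) :
    Summable fun j : ℤ => C * r ^ j.natAbs := by
  apply Summable.mul_left
  apply Summable.of_nat_of_neg
  · simpa using summable_geometric_of_lt_one h0 h1
  · simpa using summable_geometric_of_lt_one h0 h1

/-- Row of index `m` of the sum. -/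
noncomputable def rowD (m : ℤ) (τ : ℂ) : ℂ :=
  rowS (1 / 2 + (2 * m + 2 : ℤ) * τ) - rowS (1 / 2 + (2 * m + 1 : ℤ) * τ)

lemma tsum_wterm_rows (τ : ℂ) (h : 0 < τ.im) : ∑' p, wterm τ p = ∑' m, rowD m τ := by
  have hs := (hasSum_wterm τ h).summable
  rw [hs.tsum_prod, ← Summable.tsum_comm (f := fun n m => wterm τ (n, m)) hs]
  congr 1; ext m
  unfold rowD rowS
  rw [← (summable_rowS _).tsum_sub (summable_rowS _)]
  congr 1; ext n
  simp only [wterm]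
  push_cast
  ring_nf

lemma exists_rowD_bound (δ : ℝ) (hδ : 0 < δ) : ∃ u : ℤ → ℝ, Summable u ∧
    ∀ (m : ℤ) (τ : ℂ), δ < τ.im → ‖rowD m τ‖ ≤ u m := by
  set r := Real.exp (-(2 * Real.pi * δ)) with hr
  have hpi := Real.pi_pos
  have hr1 : r < 1 := by
    rw [hr, Real.exp_lt_one_iff]; have : 0 < 2 * Real.pi * δ := by positivity
    linarith
  have hr0 : 0 ≤ r := (Real.exp_pos _).le
  set C := (2 * Real.pi) ^ 2 / (1 - r) ^ 2 with hC
  have hC0 : 0 ≤ C := by positivity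
  set b : ℤ → ℝ := fun j => (‖rowS (1 / 2)‖ + C) * r ^ j.natAbs with hb
  have hsum : Summable b := summable_pow_natAbs _ r hr0 hr1
  have key : ∀ (j : ℤ) (τ : ℂ), δ < τ.im → ‖rowS (1 / 2 + j * τ)‖ ≤ b j := by
    intro j τ hτ
    rcases eq_or_ne j 0 with rfl | hj
    · simp [hb]
      simpa using hC0
    · refine (rowS_bound δ hδ j.natAbs (Int.natAbs_pos.2 hj) _ ?_).trans ?_
      · have : (1 / 2 + (j : ℂ) * τ).im = j * τ.im := by simp
        rw [this, abs_mul, abs_of_pos (hδ.trans hτ), Nat.cast_natAbs, Int.cast_abs]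
        gcongr
      · rw [hb]
        simp only
        gcongr
        linarith [norm_nonneg (rowS (1 / 2))]
  refine ⟨fun m => b (2 * m + 2) + b (2 * m + 1), ?_, ?_⟩
  · apply Summable.add
    · exact hsum.comp_injective (i := fun m : ℤ => 2 * m + 2) (fun x y h => by simp at h; omega)
    · exact hsum.comp_injective (i := fun m : ℤ => 2 * m + 1) (fun x y h => by simp at h; omega)
  · intro m τ hτ
    exact (norm_sub_le _ _).trans (add_le_add (key _ τ hτ) (key _ τ hτ))

lemma rowD_differentiableAt (m : ℤ) (τ : ℂ) (h : 0 < τ.im) : DifferentiableAt ℂ (rowD m) τ := by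
  have key : ∀ j : ℤ, DifferentiableAt ℂ (fun τ : ℂ => rowS (1 / 2 + j * τ)) τ := by
    intro j
    rcases eq_or_ne j 0 with rfl | hj
    · simp
    · apply DifferentiableAt.comp (g := rowS) (f := fun τ : ℂ => 1 / 2 + (j : ℂ) * τ)
      · apply rowS_differentiableAt
        simp [hj, h.ne']
      · fun_prop
  exact (key _).sub (key _)

lemma wpt_differentiableAt (τ : ℂ) (h : 0 < τ.im) :
    DifferentiableAt ℂ (fun τ : ℂ => wpt τ (2 * τ)) τ := by
  obtain ⟨u, hu, hb⟩ := exists_rowD_bound (τ.im / 2) (by linarith)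
  have hopen : IsOpen {z : ℂ | τ.im / 2 < z.im} := isOpen_lt continuous_const Complex.continuous_im
  have hd : DifferentiableOn ℂ (fun z => ∑' m, rowD m z) {z : ℂ | τ.im / 2 < z.im} := by
    apply differentiableOn_tsum_of_summable_norm hu _ hopen
    · intro i w hw
      exact hb i w hw
    · intro i z hz
      have hz' : τ.im / 2 < z.im := hz
      exact (rowD_differentiableAt i z (by linarith)).differentiableWithinAt
  have hmem : {z : ℂ | τ.im / 2 < z.im} ∈ nhds τ :=
    hopen.mem_nhds (by change τ.im / 2 < τ.im; linarith)
  refine ((hd.differentiableAt hmem).const_mul ((Real.pi : ℂ)⁻¹ ^ 2)).congr_of_eventuallyEq ?_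
  filter_upwards [hmem] with z hz
  have hz' : τ.im / 2 < z.im := hz
  rw [wpt_eq_tsum, tsum_wterm_rows z (by linarith)]

lemma wpt_bounded : ∃ M : ℝ, ∀ τ : ℂ, 1 < τ.im → ‖wpt τ (2 * τ)‖ ≤ M := by
  obtain ⟨u, hu, hb⟩ := exists_rowD_bound 1 one_pos
  refine ⟨‖(Real.pi : ℂ)⁻¹ ^ 2‖ * ∑' m, u m, fun τ hτ => ?_⟩
  rw [wpt_eq_tsum, tsum_wterm_rows τ (by linarith), norm_mul]
  gcongr
  exact tsum_of_norm_bounded hu.hasSum fun m => hb m τ hτ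

lemma wpt_bounded_S : ∃ M : ℝ, ∀ τ z : ℂ, 1 < τ.im → 0 < z.im → z * τ = -1 →
    ‖wpt z (2 * z) * (τ ^ 2)⁻¹‖ ≤ M := by
  set r := Real.exp (-(2 * Real.pi * (1 / 4))) with hr
  have hpi := Real.pi_pos
  have hr1 : r < 1 := by
    rw [hr, Real.exp_lt_one_iff]; have : 0 < 2 * Real.pi * (1 / 4) := by positivity
    linarith
  have hr0 : 0 ≤ r := (Real.exp_pos _).le
  set C := (2 * Real.pi) ^ 2 / (1 - r) ^ 2 with hC
  have hsum : Summable fun n : ℤ => 2 * (C * r ^ (2 * n + 1).natAbs) :=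
    ((summable_pow_natAbs C r hr0 hr1).comp_injective (i := fun m : ℤ => 2 * m + 1)
      (fun x y h => by simp at h; omega)).mul_left 2
  refine ⟨‖(Real.pi : ℂ)⁻¹ ^ 2‖ * ∑' n : ℤ, 2 * (C * r ^ (2 * n + 1).natAbs), ?_⟩
  intro τ z hτ hz hzτ
  have hs := (hasSum_wterm z hz).summable
  have hτ0 : τ ≠ 0 := by rintro rfl; simp at hzτ
  have hz1 : z = -1 / τ := by field_simp; exact hzτ
  rw [wpt_eq_tsum, mul_assoc, ← tsum_mul_right, norm_mul]
  gcongr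
  rw [(hs.mul_right _).tsum_prod]
  refine tsum_of_norm_bounded hsum.hasSum fun n => ?_
  have e : ∀ m : ℤ, wterm z (n, m) * (τ ^ 2)⁻¹ =
      1 / 4 * (1 / ((-((n + 1 / 2) * τ / 2) + 1) + m) ^ 2
        - 1 / ((-((n + 1 / 2) * τ / 2) + 1 / 2) + m) ^ 2) := by
    intro m
    have e0 : ∀ x y : ℂ, x * τ = -2 * y → 1 / x ^ 2 * (τ ^ 2)⁻¹ = 1 / 4 * (1 / y ^ 2) := by
      intro x y hxy
      have : 1 / x ^ 2 * (τ ^ 2)⁻¹ = 1 / (x * τ) ^ 2 := by rw [mul_pow]; simp [mul_comm]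
      rw [this, hxy, mul_pow]; simp; ring
    simp only [wterm]
    rw [sub_mul, mul_sub]
    congr 1
    · apply e0; linear_combination (2 * m + 2) * hzτ
    · apply e0; linear_combination (2 * m + 1) * hzτ
  simp only [e]
  rw [tsum_mul_left, (summable_rowS _).tsum_sub (summable_rowS _)]
  have key : ∀ t : ℂ, t.im = 0 → ‖rowS (-((n + 1 / 2) * τ / 2) + t)‖ ≤
      C * r ^ (2 * n + 1).natAbs := by
    intro t ht
    apply rowS_bound (1 / 4) (by norm_num) (2 * n + 1).natAbs (Int.natAbs_pos.2 (by omega))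
    have him : (-((n + 1 / 2) * τ / 2) + t).im = -((2 * n + 1 : ℤ) * (τ.im / 4)) := by
      have : (-((n + 1 / 2) * τ / 2) + t) = -(((2 * n + 1 : ℤ) / 4 : ℝ) : ℂ) * τ + t := by
        push_cast; ring
      rw [this]
      simp only [add_im, ht, neg_mul, neg_im, im_ofReal_mul]
      ring
    rw [him, abs_neg, abs_mul, abs_of_pos (by linarith : 0 < τ.im / 4), Nat.cast_natAbs,
      Int.cast_abs]
    gcongr
  have k1 := key 1 (by simp)
  have k2 := key (1 / 2) (by simp)
  change ‖1 / 4 * (rowS (-((n + 1 / 2) * τ / 2) + 1) - rowS (-((n + 1 / 2) * τ / 2) + 1 / 2))‖ ≤ _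
  rw [norm_mul]
  have k3 := norm_sub_le (rowS (-((n + 1 / 2) * τ / 2) + 1)) (rowS (-((n + 1 / 2) * τ / 2) + 1 / 2))
  have k4 : ‖(1 / 4 : ℂ)‖ ≤ 1 := by norm_num
  refine (mul_le_of_le_one_left (norm_nonneg _) k4).trans ?_
  linarith

open UpperHalfPlane ModularForm in
lemma sqform_slash_Gamma0 (γ : Matrix.SpecialLinearGroup (Fin 2) ℤ)
    (hγ : γ ∈ CongruenceSubgroup.Gamma0 2) :
    (fun τ : ℍ => wpt (τ : ℂ) (2 * (τ : ℂ)) ^ 2) ∣[(4 : ℤ)] γ =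
      fun τ : ℍ => wpt (τ : ℂ) (2 * (τ : ℂ)) ^ 2 := by
  ext τ
  rw [ModularForm.SL_slash_apply]
  rw [CongruenceSubgroup.Gamma0_mem] at hγ
  obtain ⟨c, hc⟩ := (ZMod.intCast_zmod_eq_zero_iff_dvd _ _).1 hγ
  have hdet := γ.det_coe
  rw [Matrix.det_fin_two] at hdet
  have hden : denom γ τ = 2 * (c : ℂ) * τ + (γ 1 1 : ℂ) := by
    rw [ModularGroup.denom_apply, hc]; push_cast; ring
  have hne : denom γ τ ≠ 0 := denom_ne_zero _ _
  have hz : ((γ • τ : ℍ) : ℂ) * (2 * (c : ℂ) * τ + (γ 1 1 : ℂ)) = (γ 0 0 : ℂ) * τ + (γ 0 1 : ℂ) := by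
    rw [← hden, UpperHalfPlane.specialLinearGroup_apply]
    have : denom γ τ = (γ 1 0 : ℂ) * τ + γ 1 1 := by rw [ModularGroup.denom_apply]
    rw [this] at hne ⊢
    simp only [algebraMap_int_eq, eq_intCast, ofReal_intCast]
    rw [div_mul_cancel₀ _ hne]
  have := wpt_core (τ : ℂ) ((γ • τ : ℍ) : ℂ) τ.im_pos (γ • τ).im_pos (γ 0 0) (γ 0 1) c (γ 1 1)
    (by rw [hc] at hdet; push_cast at hdet; linarith) hz
  rw [this, ← hden]
  rw [zpow_neg, mul_comm, ← mul_assoc]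
  norm_cast
  rw [inv_mul_cancel₀ (pow_ne_zero 4 hne), one_mul]

open UpperHalfPlane ModularForm in
lemma sqform_bdd : IsBoundedAtImInfty (fun τ : ℍ => wpt (τ : ℂ) (2 * (τ : ℂ)) ^ 2) := by
  obtain ⟨M, hM⟩ := wpt_bounded
  rw [isBoundedAtImInfty_iff]
  refine ⟨M ^ 2, 2, fun τ hτ => ?_⟩
  rw [norm_pow]
  have := hM (τ : ℂ) (by simpa using (by norm_num : (1 : ℝ) < 2).trans_le hτ)
  gcongr

open UpperHalfPlane ModularForm in
lemma sqform_bdd_S : IsBoundedAtImInfty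
    ((fun τ : ℍ => wpt (τ : ℂ) (2 * (τ : ℂ)) ^ 2) ∣[(4 : ℤ)] ModularGroup.S) := by
  obtain ⟨M, hM⟩ := wpt_bounded_S
  rw [isBoundedAtImInfty_iff]
  refine ⟨M ^ 2, 2, fun τ hτ => ?_⟩
  rw [SlashInvariantForm.slash_S_apply]
  have h1 : 1 < (τ : ℂ).im := by simpa using (by norm_num : (1 : ℝ) < 2).trans_le hτ
  have := hM (τ : ℂ) (-(τ : ℂ))⁻¹ h1 τ.im_inv_neg_coe_pos
    (by rw [inv_neg, neg_mul, inv_mul_cancel₀ τ.ne_zero])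
  have e : (wpt (-(τ : ℂ))⁻¹ (2 * (-(τ : ℂ))⁻¹) * ((τ : ℂ) ^ 2)⁻¹) ^ 2 =
      wpt (-(τ : ℂ))⁻¹ (2 * (-(τ : ℂ))⁻¹) ^ 2 * (τ : ℂ) ^ (-4 : ℤ) := by
    rw [mul_pow, zpow_neg, inv_pow, ← pow_mul]; norm_cast
  change ‖wpt (-(τ : ℂ))⁻¹ (2 * (-(τ : ℂ))⁻¹) ^ 2 * (τ : ℂ) ^ (-4 : ℤ)‖ ≤ _
  rw [← e, norm_pow]
  gcongr

open UpperHalfPlane ModularForm in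
lemma sqform_bdd_SL (γ : Matrix.SpecialLinearGroup (Fin 2) ℤ) : IsBoundedAtImInfty
    ((fun τ : ℍ => wpt (τ : ℂ) (2 * (τ : ℂ)) ^ 2) ∣[(4 : ℤ)] γ) := by
  rcases Int.even_or_odd (γ 1 0) with hc | hc
  · rw [sqform_slash_Gamma0 γ]
    · exact sqform_bdd
    · rw [CongruenceSubgroup.Gamma0_mem]
      exact (ZMod.intCast_zmod_eq_zero_iff_dvd _ _).2 (by exact_mod_cast hc.two_dvd)
  · set j : ℤ := γ 1 1 with hj
    set γ₀ := γ * ModularGroup.T ^ (-j) * ModularGroup.S⁻¹ with hγ₀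
    have hmem : γ₀ ∈ CongruenceSubgroup.Gamma0 2 := by
      rw [CongruenceSubgroup.Gamma0_mem]
      apply (ZMod.intCast_zmod_eq_zero_iff_dvd _ _).2
      have : γ₀ 1 0 = j * γ 1 0 - j := by
        rw [hγ₀, Matrix.SpecialLinearGroup.coe_mul, Matrix.SpecialLinearGroup.coe_mul,
          ModularGroup.coe_T_zpow, Matrix.SpecialLinearGroup.coe_inv, ModularGroup.coe_S,
          Matrix.adjugate_fin_two]
        simp [Matrix.mul_apply, Fin.sum_univ_two, ← hj]
        ring
      rw [this]
      obtain ⟨t, ht⟩ := hc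
      exact ⟨j * t, by rw [ht]; push_cast; ring⟩
    have hγ : γ = γ₀ * ModularGroup.S * ModularGroup.T ^ j := by
      rw [hγ₀]; simp [mul_assoc]
    rw [hγ, SlashAction.slash_mul, SlashAction.slash_mul, sqform_slash_Gamma0 γ₀ hmem]
    rw [SL_slash]
    apply IsBoundedAtImInfty.slash _ _ sqform_bdd_S
    change (((ModularGroup.T ^ j) 1 0 : ℤ) : ℝ) = 0
    rw [ModularGroup.coe_T_zpow]
    simp

open UpperHalfPlane in
/-- `℘̃a(τ/(2τ+1), 2τ/(2τ+1))² = (2τ+1)⁴ ℘̃a(τ, 2τ)²`; consequently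
`τ ↦ ℘̃a(τ, 2τ)²` is a modular form of weight 4 for `Γ₀(2)`. -/
theorem wpt_sq_gamma0_two :
    (∀ τ : ℂ, 0 < τ.im →
        wpt (τ / (2 * τ + 1)) (2 * τ / (2 * τ + 1)) ^ 2 = (2 * τ + 1) ^ 4 * wpt τ (2 * τ) ^ 2) ∧
      ∃ f : ModularForm (CongruenceSubgroup.Gamma0 2) 4,
        ∀ τ : UpperHalfPlane, f τ = wpt (τ : ℂ) (2 * (τ : ℂ)) ^ 2 := by
  constructor
  · intro τ hτ
    have hne : 2 * τ + 1 ≠ 0 := by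
      intro h0
      have := congrArg Complex.im h0
      simp at this
      exact hτ.ne' this
    have him : 0 < (τ / (2 * τ + 1)).im := by
      have : (τ / (2 * τ + 1)).im = τ.im / Complex.normSq (2 * τ + 1) := by
        rw [Complex.div_im]; simp; ring
      rw [this]
      exact div_pos hτ (Complex.normSq_pos.2 hne)
    have := wpt_core τ (τ / (2 * τ + 1)) hτ him 1 0 1 1 (by norm_num)
      (by push_cast; rw [mul_one, div_mul_cancel₀ _ hne]; ring)
    push_cast at this
    rw [mul_div_assoc, this, mul_one]
  · refine ⟨{ toFun := fun τ : ℍ => wpt (τ : ℂ) (2 * (τ : ℂ)) ^ 2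
              slash_action_eq' := ?_
              holo' := ?_
              bdd_at_cusps' := ?_ }, fun τ => rfl⟩
    · rintro A ⟨A, hA, rfl⟩
      exact sqform_slash_Gamma0 A hA
    · refine UpperHalfPlane.mdifferentiable_iff.2 ?_
      intro z hz
      have hd := ((wpt_differentiableAt z hz).pow 2).differentiableWithinAt (s := {z : ℂ | 0 < z.im})
      refine hd.congr (fun w hw => ?_) ?_
      · simp [UpperHalfPlane.ofComplex_apply_of_im_pos hw]
      · simp [UpperHalfPlane.ofComplex_apply_of_im_pos hz]
    · intro c hc
      rw [Subgroup.IsArithmetic.isCusp_iff_isCusp_SL2Z] at hc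
      rw [OnePoint.isBoundedAt_iff_forall_SL2Z hc]
      exact fun γ _ => sqform_bdd_SL γ
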